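/- arXiv:1802.08175 — 11 statements merged into one kernel-verified Lean document; each statement's English description precedes it below -/
import Mathlib

section
/- Let φ : ℂ[P₁₁₁,P₁₁₂,P₁₂₁,P₁₂₂,P₂₁₁,P₂₁₂,P₂₂₁,P₂₂₂] → ℂ[ζ,γ₁,γ₂,a₁,a₂,b₁,b₂,c₁,c₂] be the ℂ-algebra homomorphism defined on the variables by φ(P_{ijk}) = ζ·γᵢ·aᵢ·bⱼ·c_k when i=j=k and φ(P_{ijk}) = ζ·aᵢ·bⱼ·c_k otherwise, for i,j,k ∈ {1,2}. Then the kernel of φ equals the ideal generated by the two binomials P₁₂₁P₂₁₂ − P₁₁₂P₂₂₁ and P₁₂₂P₂₁₁ − P₁₂₁P₂₁₂. -/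
open MvPolynomial

/-- Parameters of the quasi-independence model `QI₂`: ζ, γ₁, γ₂, a₁, a₂, b₁, b₂, c₁, c₂. -/
inductive Param : Type
  | zeta : Param
  | gamma : Fin 2 → Param
  | a : Fin 2 → Param
  | b : Fin 2 → Param
  | c : Fin 2 → Param

/-- The monomial parametrization map of the model `QI₂`:
`P_{ijk} ↦ ζ γᵢ aᵢ bⱼ c_k` if `i = j = k`, and `P_{ijk} ↦ ζ aᵢ bⱼ c_k` otherwise.
Indices in `Fin 2`: `0` stands for `1` and `1` stands for `2`. -/
noncomputable def phi : MvPolynomial (Fin 2 × Fin 2 × Fin 2) ℂ →ₐ[ℂ] MvPolynomial Param ℂ :=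
  aeval fun v : Fin 2 × Fin 2 × Fin 2 =>
    if v.1 = v.2.1 ∧ v.2.1 = v.2.2 then
      X Param.zeta * X (Param.gamma v.1) * X (Param.a v.1) * X (Param.b v.2.1) *
        X (Param.c v.2.2)
    else
      X Param.zeta * X (Param.a v.1) * X (Param.b v.2.1) * X (Param.c v.2.2)

open Classical in
/-- Exponent vectors of the parametrization. -/
noncomputable def qiD (v : Fin 2 × Fin 2 × Fin 2) : Param →₀ ℕ :=
  if v.1 = v.2.1 ∧ v.2.1 = v.2.2 then
    Finsupp.single Param.zeta 1 + Finsupp.single (Param.gamma v.1) 1 +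
      Finsupp.single (Param.a v.1) 1 + Finsupp.single (Param.b v.2.1) 1 +
      Finsupp.single (Param.c v.2.2) 1
  else
    Finsupp.single Param.zeta 1 +
      Finsupp.single (Param.a v.1) 1 + Finsupp.single (Param.b v.2.1) 1 +
      Finsupp.single (Param.c v.2.2) 1

lemma phi_X_qi (v : Fin 2 × Fin 2 × Fin 2) : phi (X v) = monomial (qiD v) 1 := by
  unfold phi qiD
  rw [aeval_X]
  split_ifs <;> simp only [X, monomial_mul, mul_one]

lemma monomial_qi (e : (Fin 2 × Fin 2 × Fin 2) →₀ ℕ) :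
    (monomial e (1 : ℂ)) = ∏ i, X i ^ e i := by
  rw [monomial_eq, C_1, one_mul, Finsupp.prod_fintype]
  simp

lemma phi_monomial_qi (e : (Fin 2 × Fin 2 × Fin 2) →₀ ℕ) :
    phi (monomial e 1) = monomial (∑ i, e i • qiD i) 1 := by
  rw [monomial_qi, map_prod, monomial_sum_one]
  refine Finset.prod_congr rfl fun i _ => ?_
  rw [map_pow, phi_X_qi, monomial_pow, one_pow]

/-- Normal form of a fibre. -/
def qiPsi {R : Type*} [CommRing R] (q : Fin 2 × Fin 2 × Fin 2 → R) (g0 g1 a0 a1 b0 b1 c0 : ℕ) :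
    R :=
  q (0,0,0) ^ g0 * q (1,1,1) ^ g1 *
  (q (0,0,1) ^ ((b0 - g0) - (a1 - g1)) * q (1,1,0) ^ ((a1 - g1) - (b0 - g0))) *
  (q (0,1,1) ^ ((b1 - g1) - (c0 - g0)) * q (1,0,0) ^ ((c0 - g0) - (b1 - g1))) *
  (q (0,1,0) ^ ((a0 - g0) - ((b0 - g0) - (a1 - g1)) - ((b1 - g1) - (c0 - g0))) *
   q (1,0,1) ^ ((a1 - g1) - ((a1 - g1) - (b0 - g0)) - ((c0 - g0) - (b1 - g1))))

lemma qi_pow {R : Type*} [CommRing R] {u v t : R} (h : u * v = t) (m n : ℕ) :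
    u ^ m * v ^ n = u ^ (m - n) * v ^ (n - m) * t ^ min m n := by
  subst h
  rcases le_total m n with h | h
  · obtain ⟨k, rfl⟩ := Nat.exists_eq_add_of_le h
    simp [mul_pow]; ring
  · obtain ⟨k, rfl⟩ := Nat.exists_eq_add_of_le h
    simp [mul_pow]; ring

lemma qi_normal {R : Type*} [CommRing R] (q : Fin 2 × Fin 2 × Fin 2 → R)
    (h1 : q (0,0,1) * q (1,1,0) = q (0,1,0) * q (1,0,1))
    (h2 : q (0,1,1) * q (1,0,0) = q (0,1,0) * q (1,0,1))
    (p r x y u v w z : ℕ) :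
    qiPsi q p r (p + x + u + w) (r + y + v + z) (p + u + y + z) (r + x + v + w) (p + x + v + z)
      = q (0,0,0) ^ p * q (1,1,1) ^ r * (q (0,0,1) ^ u * q (1,1,0) ^ v) *
        (q (0,1,1) ^ w * q (1,0,0) ^ z) * (q (0,1,0) ^ x * q (1,0,1) ^ y) := by
  rw [qi_pow h1, qi_pow h2]
  unfold qiPsi
  have e1 : (p + u + y + z - p) - (r + y + v + z - r) = u - v := by omega
  have e2 : (r + y + v + z - r) - (p + u + y + z - p) = v - u := by omega
  have e3 : (r + x + v + w - r) - (p + x + v + z - p) = w - z := by omega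
  have e4 : (p + x + v + z - p) - (r + x + v + w - r) = z - w := by omega
  have e5 : (p + x + u + w - p) - (u - v) - (w - z) = x + min u v + min w z := by omega
  have e6 : (r + y + v + z - r) - (v - u) - (z - w) = y + min u v + min w z := by omega
  rw [e1, e2, e3, e4, e5, e6]
  simp only [mul_pow, pow_add]
  ring

/-- The kernel of the parametrization map of `QI₂` is generated by the two binomials
`P₁₂₁P₂₁₂ − P₁₁₂P₂₂₁` and `P₁₂₂P₂₁₁ − P₁₂₁P₂₁₂`. -/
theorem QI2_invariants :
    RingHom.ker phi =
      Ideal.span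
        ({X (0, 1, 0) * X (1, 0, 1) - X (0, 0, 1) * X (1, 1, 0),
          X (0, 1, 1) * X (1, 0, 0) - X (0, 1, 0) * X (1, 0, 1)} :
          Set (MvPolynomial (Fin 2 × Fin 2 × Fin 2) ℂ)) := by
  set I := Ideal.span
        ({X (0, 1, 0) * X (1, 0, 1) - X (0, 0, 1) * X (1, 1, 0),
          X (0, 1, 1) * X (1, 0, 0) - X (0, 1, 0) * X (1, 0, 1)} :
          Set (MvPolynomial (Fin 2 × Fin 2 × Fin 2) ℂ)) with hI
  apply le_antisymm
  · let q : Fin 2 × Fin 2 × Fin 2 → MvPolynomial (Fin 2 × Fin 2 × Fin 2) ℂ ⧸ I :=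
      fun i => Ideal.Quotient.mkₐ ℂ I (X i)
    have h1 : q (0,0,1) * q (1,1,0) = q (0,1,0) * q (1,0,1) := by
      simp only [q, ← map_mul]
      symm
      exact Ideal.Quotient.eq.2 (Ideal.subset_span (by simp))
    have h2 : q (0,1,1) * q (1,0,0) = q (0,1,0) * q (1,0,1) := by
      simp only [q, ← map_mul]
      exact Ideal.Quotient.eq.2 (Ideal.subset_span (by simp))
    let ψ : MvPolynomial Param ℂ →ₗ[ℂ] MvPolynomial (Fin 2 × Fin 2 × Fin 2) ℂ ⧸ I :=
      (basisMonomials Param ℂ).constr ℂ fun d =>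
        qiPsi q (d (.gamma 0)) (d (.gamma 1)) (d (.a 0)) (d (.a 1)) (d (.b 0)) (d (.b 1))
          (d (.c 0))
    have hψ (d) : ψ (monomial d 1) =
        qiPsi q (d (.gamma 0)) (d (.gamma 1)) (d (.a 0)) (d (.a 1)) (d (.b 0)) (d (.b 1))
          (d (.c 0)) := by
      have := (basisMonomials Param ℂ).constr_basis ℂ (fun d =>
        qiPsi q (d (.gamma 0)) (d (.gamma 1)) (d (.a 0)) (d (.a 1)) (d (.b 0)) (d (.b 1))
          (d (.c 0))) d
      rwa [coe_basisMonomials] at this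
    have key : ψ ∘ₗ phi.toLinearMap = (Ideal.Quotient.mkₐ ℂ I).toLinearMap := by
      apply (basisMonomials (Fin 2 × Fin 2 × Fin 2) ℂ).ext
      intro e
      rw [coe_basisMonomials]
      simp only [LinearMap.comp_apply, AlgHom.toLinearMap_apply]
      rw [phi_monomial_qi, hψ, monomial_qi, map_prod]
      have hn := qi_normal q h1 h2 (e (0,0,0)) (e (1,1,1)) (e (0,1,0)) (e (1,0,1)) (e (0,0,1))
        (e (1,1,0)) (e (0,1,1)) (e (1,0,0))
      have hr : ∏ i, Ideal.Quotient.mkₐ ℂ I (X i ^ e i) = ∏ i, q i ^ e i :=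
        Finset.prod_congr rfl fun i _ => map_pow _ _ _
      rw [hr]
      refine Eq.trans ?_ (hn.trans ?_)
      · congr 1 <;>
          simp [Fintype.sum_prod_type, Fin.sum_univ_two, qiD, Finsupp.single_apply] <;> ring
      · simp only [Fintype.prod_prod_type, Fin.prod_univ_two]
        ring
    intro f hf
    have := LinearMap.congr_fun key f
    simp only [LinearMap.comp_apply, AlgHom.toLinearMap_apply] at this
    rw [(RingHom.mem_ker).1 hf, map_zero] at this
    exact Ideal.Quotient.eq_zero_iff_mem.1 this.symm
  · rw [hI, Ideal.span_le]
    rintro f (rfl | rfl) <;>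
    · simp only [SetLike.mem_coe, RingHom.mem_ker, map_sub, map_mul]
      simp [phi]
      ring
end

section
/- Fix n ≥ 1 and let f be a polynomial over ℂ in the n³ variables P_{ijk}, 1 ≤ i,j,k ≤ n. Then the following are equivalent: (a) f vanishes at every point of the form P_{ijk} = ζγᵢaᵢbⱼc_k for i=j=k and P_{ijk} = ζaᵢbⱼc_k otherwise, for all choices of ζ, γ₁,…,γₙ, a, b, c ∈ ℂ; and (b) f vanishes at every point of the form P_{ijk} = s·aᵢbⱼc_k + dᵢ for i=j=k and P_{ijk} = s·aᵢbⱼc_k otherwise, for all choices of s, a, b, c, d ∈ ℂ. That is, the models QIₙ and Mixₙ have the same invariants. -/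
open MvPolynomial

/-- A polynomial `f` in the `n³` variables `P_{ijk}` vanishes on every tensor of the
quasi-independence model `QIₙ` (`P_{ijk} = ζ γᵢ aᵢ bⱼ c_k` on the diagonal,
`P_{ijk} = ζ aᵢ bⱼ c_k` off the diagonal) if and only if it vanishes on every tensor of the
mixture model `Mixₙ` (`P_{ijk} = s aᵢ bⱼ c_k + dᵢ` on the diagonal,
`P_{ijk} = s aᵢ bⱼ c_k` off the diagonal): the two models have the same invariants. -/
theorem QI_Mix_same_invariants (n : ℕ) (hn : 1 ≤ n)
    (f : MvPolynomial (Fin n × Fin n × Fin n) ℂ) :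
    (∀ (ζ : ℂ) (γ a b c : Fin n → ℂ),
        MvPolynomial.eval (fun v : Fin n × Fin n × Fin n =>
          if v.1 = v.2.1 ∧ v.2.1 = v.2.2 then ζ * γ v.1 * a v.1 * b v.2.1 * c v.2.2
          else ζ * a v.1 * b v.2.1 * c v.2.2) f = 0) ↔
      (∀ (s : ℂ) (a b c d : Fin n → ℂ),
        MvPolynomial.eval (fun v : Fin n × Fin n × Fin n =>
          if v.1 = v.2.1 ∧ v.2.1 = v.2.2 then s * a v.1 * b v.2.1 * c v.2.2 + d v.1
          else s * a v.1 * b v.2.1 * c v.2.2) f = 0) := by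
  constructor
  · intro h s a b c d
    let g : ℂ → ℂ := fun t => MvPolynomial.eval (fun v : Fin n × Fin n × Fin n =>
          if v.1 = v.2.1 ∧ v.2.1 = v.2.2 then
            (s + t) * (a v.1 + t) * (b v.2.1 + t) * (c v.2.2 + t) + d v.1
          else (s + t) * (a v.1 + t) * (b v.2.1 + t) * (c v.2.2 + t)) f
    have hg : Continuous g := by
      refine (MvPolynomial.continuous_eval f).comp (continuous_pi fun v => ?_)
      split_ifs <;> fun_prop
    let B : Set ℂ := {-s} ∪ Set.range (fun i => -a i) ∪ Set.range (fun i => -b i) ∪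
      Set.range (fun i => -c i)
    have hB : B.Finite :=
      (((Set.finite_singleton _).union (Set.finite_range _)).union (Set.finite_range _)).union
        (Set.finite_range _)
    have hd : Dense Bᶜ := hB.countable.dense_compl ℂ
    have h0 : g = fun _ => 0 := by
      refine Continuous.ext_on hd hg continuous_const ?_
      intro t ht
      have hs : s + t ≠ 0 := fun e => ht (Or.inl (Or.inl (Or.inl (eq_neg_of_add_eq_zero_right e))))
      have ha : ∀ i, a i + t ≠ 0 := fun i e =>
        ht (Or.inl (Or.inl (Or.inr ⟨i, (eq_neg_of_add_eq_zero_right e).symm⟩)))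
      have hb : ∀ i, b i + t ≠ 0 := fun i e =>
        ht (Or.inl (Or.inr ⟨i, (eq_neg_of_add_eq_zero_right e).symm⟩))
      have hc : ∀ i, c i + t ≠ 0 := fun i e =>
        ht (Or.inr ⟨i, (eq_neg_of_add_eq_zero_right e).symm⟩)
      have key := h (s + t)
        (fun i => 1 + d i / ((s + t) * (a i + t) * (b i + t) * (c i + t)))
        (fun i => a i + t) (fun i => b i + t) (fun i => c i + t)
      refine Eq.trans ?_ key
      show MvPolynomial.eval _ f = _
      congr 2
      funext ⟨i, j, k⟩
      dsimp only
      split_ifs with hv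
      · obtain ⟨rfl, rfl⟩ := hv
        have h1 := ha i
        have h2 := hb i
        have h3 := hc i
        field_simp
      · rfl
    have := congrFun h0 0
    simpa [g] using this
  · intro h ζ γ a b c
    refine Eq.trans ?_ (h ζ a b c (fun i => (γ i - 1) * (ζ * a i * b i * c i)))
    congr 2
    funext ⟨i, j, k⟩
    dsimp only
    split_ifs with hv
    · obtain ⟨rfl, rfl⟩ := hv
      ring
    · rfl
end

section
/- Fix n ≥ 1, let ζ, γ ∈ ℂ and a, b, c ∈ ℂⁿ, and define the n×n×n tensor P by P_{ijk} = ζγaᵢbⱼc_k if i=j=k and P_{ijk} = ζaᵢbⱼc_k otherwise. Let α, β : {1,…,n}³ → ℕ be exponent functions such that (i) for each position s ∈ {1,2,3} and each value t ∈ {1,…,n}, the total α-exponent of triples whose s-th index equals t coincides with the corresponding total β-exponent, and (ii) Σᵢ α(i,i,i) = Σᵢ β(i,i,i). Then ∏_{(i,j,k)} P_{ijk}^{α(i,j,k)} = ∏_{(i,j,k)} P_{ijk}^{β(i,j,k)}; consequently the binomial ∏ P^{α} − ∏ P^{β} is an invariant of the model qIₙ. -/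
theorem qI_aux_prod {V T : Type*} [Fintype V] [Fintype T] [DecidableEq T] (g : V → T)
    (f : T → ℂ) (α : V → ℕ) :
    (∏ v, f (g v) ^ α v) = ∏ t, f t ^ (∑ v, if g v = t then α v else 0) := by
  simp_rw [← Finset.prod_pow_eq_pow_sum]
  rw [Finset.prod_comm]
  refine Finset.prod_congr rfl fun v _ => ?_
  rw [Finset.prod_eq_single (g v)]
  · simp
  · intro t _ ht
    simp [Ne.symm ht]
  · simp

theorem qI_aux_sum {V T : Type*} [Fintype V] [Fintype T] [DecidableEq T] (g : V → T)
    (α : V → ℕ) :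
    (∑ v, α v) = ∑ t, ∑ v, if g v = t then α v else 0 := by
  rw [Finset.sum_comm]
  simp

theorem qI_aux_diag (n : ℕ) (α : Fin n × Fin n × Fin n → ℕ) :
    (∑ v : Fin n × Fin n × Fin n, if v.1 = v.2.1 ∧ v.2.1 = v.2.2 then α v else 0) =
      ∑ i, α (i, i, i) := by
  simp [Fintype.sum_prod_type, ite_and]

theorem qI_aux_expand (n : ℕ) (ζ γ : ℂ) (a b c : Fin n → ℂ)
    (α : Fin n × Fin n × Fin n → ℕ) :
    (∏ v : Fin n × Fin n × Fin n,
      (if v.1 = v.2.1 ∧ v.2.1 = v.2.2 then ζ * γ * a v.1 * b v.2.1 * c v.2.2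
      else ζ * a v.1 * b v.2.1 * c v.2.2) ^ α v) =
    ζ ^ (∑ v, α v) * γ ^ (∑ i, α (i, i, i)) * (∏ v, a v.1 ^ α v) * (∏ v, b v.2.1 ^ α v) *
      ∏ v, c v.2.2 ^ α v := by
  rw [← qI_aux_diag, ← Finset.prod_pow_eq_pow_sum, ← Finset.prod_pow_eq_pow_sum]
  simp_rw [← Finset.prod_mul_distrib]
  refine Finset.prod_congr rfl fun v _ => ?_
  split_ifs <;> simp [mul_pow]

/-- Binomial invariants of the model `qIₙ`.  If the exponent functions `α`, `β` have, for
each position `s ∈ {1,2,3}` and each value `t`, the same total exponent over the triples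
whose `s`-th index equals `t`, and moreover involve the same total number of diagonal
variables, then the two monomials take the same value on every tensor of the model `qIₙ`
(`P_{ijk} = ζ γ aᵢ bⱼ c_k` on the diagonal, `P_{ijk} = ζ aᵢ bⱼ c_k` off the diagonal). -/
theorem qI_binomial_invariants (n : ℕ) (hn : 1 ≤ n) (ζ γ : ℂ) (a b c : Fin n → ℂ)
    (α β : Fin n × Fin n × Fin n → ℕ)
    (hcol : ∀ (s : Fin 3) (t : Fin n),
      (∑ v : Fin n × Fin n × Fin n, if ![v.1, v.2.1, v.2.2] s = t then α v else 0) =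
        ∑ v : Fin n × Fin n × Fin n, if ![v.1, v.2.1, v.2.2] s = t then β v else 0)
    (hdiag : (∑ i : Fin n, α (i, i, i)) = ∑ i : Fin n, β (i, i, i)) :
    let P : Fin n × Fin n × Fin n → ℂ := fun v =>
      if v.1 = v.2.1 ∧ v.2.1 = v.2.2 then ζ * γ * a v.1 * b v.2.1 * c v.2.2
      else ζ * a v.1 * b v.2.1 * c v.2.2
    (∏ v : Fin n × Fin n × Fin n, P v ^ α v) = ∏ v : Fin n × Fin n × Fin n, P v ^ β v := by
  intro P
  have h0 : ∀ t : Fin n, (∑ v : Fin n × Fin n × Fin n, if v.1 = t then α v else 0) =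
      ∑ v : Fin n × Fin n × Fin n, if v.1 = t then β v else 0 := hcol 0
  have h1 : ∀ t : Fin n, (∑ v : Fin n × Fin n × Fin n, if v.2.1 = t then α v else 0) =
      ∑ v : Fin n × Fin n × Fin n, if v.2.1 = t then β v else 0 := hcol 1
  have h2 : ∀ t : Fin n, (∑ v : Fin n × Fin n × Fin n, if v.2.2 = t then α v else 0) =
      ∑ v : Fin n × Fin n × Fin n, if v.2.2 = t then β v else 0 := hcol 2
  have hs : (∑ v, α v) = ∑ v, β v := by
    rw [qI_aux_sum (fun v => v.1) α, qI_aux_sum (fun v => v.1) β]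
    exact Finset.sum_congr rfl fun t _ => h0 t
  simp only [P]
  rw [qI_aux_expand, qI_aux_expand, hs, hdiag,
    qI_aux_prod (fun v => v.1) a α, qI_aux_prod (fun v => v.2.1) b α,
    qI_aux_prod (fun v => v.2.2) c α,
    qI_aux_prod (fun v => v.1) a β, qI_aux_prod (fun v => v.2.1) b β,
    qI_aux_prod (fun v => v.2.2) c β]
  simp only [h0, h1, h2]
end

section
/- Fix n ≥ 1, let s ∈ ℂ and a, b, c, d ∈ ℂⁿ, and define the n×n×n tensor P by P_{ijk} = s·aᵢbⱼc_k + dᵢ if i=j=k and P_{ijk} = s·aᵢbⱼc_k otherwise. Let α, β : {1,…,n}³ → ℕ be exponent functions such that (i) for each position s' ∈ {1,2,3} and each value t, the total α-exponent of triples whose s'-th index equals t coincides with the corresponding total β-exponent, and (ii) α(i,i,i) = β(i,i,i) for every i ∈ {1,…,n}. Then ∏_{(i,j,k)} P_{ijk}^{α(i,j,k)} = ∏_{(i,j,k)} P_{ijk}^{β(i,j,k)}. The same equality holds for tensors of the form P_{ijk} = ζγᵢaᵢbⱼc_k if i=j=k and P_{ijk} = ζaᵢbⱼc_k otherwise; hence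 such binomials ∏P^{α} − ∏P^{β} are common invariants of QIₙ and Mixₙ. -/
theorem aux_fiber {V T : Type*} [Fintype V] [Fintype T] [DecidableEq T] (p : V → T)
    (f : T → ℂ) (α : V → ℕ) :
    ∏ v, f (p v) ^ α v = ∏ t, f t ^ (∑ v, if p v = t then α v else 0) := by
  simp_rw [← Finset.prod_pow_eq_pow_sum]
  rw [Finset.prod_comm]
  refine Finset.prod_congr rfl fun v _ => ?_
  rw [Finset.prod_eq_single (p v)]
  · simp
  · intro t _ ht
    simp [Ne.symm ht]
  · simp

theorem aux_sum {V T : Type*} [Fintype V] [Fintype T] [DecidableEq T] (p : V → T)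
    (α : V → ℕ) : ∑ v, α v = ∑ t, ∑ v, if p v = t then α v else 0 := by
  rw [Finset.sum_comm]
  simp

theorem aux_main {n : ℕ} (s : ℂ) (a b c : Fin n → ℂ) (D : Fin n × Fin n × Fin n → ℂ)
    (α β : Fin n × Fin n × Fin n → ℕ)
    (hcol : ∀ (s' : Fin 3) (t : Fin n),
      (∑ v : Fin n × Fin n × Fin n, if ![v.1, v.2.1, v.2.2] s' = t then α v else 0) =
        ∑ v : Fin n × Fin n × Fin n, if ![v.1, v.2.1, v.2.2] s' = t then β v else 0)
    (hdiag : ∀ i : Fin n, α (i, i, i) = β (i, i, i)) :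
    (∏ v : Fin n × Fin n × Fin n, (if v.1 = v.2.1 ∧ v.2.1 = v.2.2 then D v
        else s * a v.1 * b v.2.1 * c v.2.2) ^ α v) =
      ∏ v : Fin n × Fin n × Fin n, (if v.1 = v.2.1 ∧ v.2.1 = v.2.2 then D v
        else s * a v.1 * b v.2.1 * c v.2.2) ^ β v := by
  have hd : ∀ v : Fin n × Fin n × Fin n, v.1 = v.2.1 ∧ v.2.1 = v.2.2 → α v = β v := by
    rintro ⟨i, j, k⟩ ⟨h1, h2⟩
    simp only at h1 h2
    subst h1 h2
    exact hdiag _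
  let off : (Fin n × Fin n × Fin n → ℕ) → Fin n × Fin n × Fin n → ℕ := fun α v =>
    if v.1 = v.2.1 ∧ v.2.1 = v.2.2 then 0 else α v
  have hsplit : ∀ α : Fin n × Fin n × Fin n → ℕ,
      (∏ v : Fin n × Fin n × Fin n, (if v.1 = v.2.1 ∧ v.2.1 = v.2.2 then D v
        else s * a v.1 * b v.2.1 * c v.2.2) ^ α v) =
      (∏ v : Fin n × Fin n × Fin n, if v.1 = v.2.1 ∧ v.2.1 = v.2.2 then D v ^ α v else 1) *
      (s ^ (∑ v, off α v) * (∏ v, a v.1 ^ off α v) * (∏ v, b v.2.1 ^ off α v) *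
        ∏ v, c v.2.2 ^ off α v) := by
    intro α
    rw [← Finset.prod_pow_eq_pow_sum]
    simp only [← Finset.prod_mul_distrib]
    refine Finset.prod_congr rfl fun v _ => ?_
    by_cases h : v.1 = v.2.1 ∧ v.2.1 = v.2.2
    · simp only [off, if_pos h]; simp
    · simp only [off, if_neg h]; ring
  have hoff : ∀ (s' : Fin 3) (t : Fin n),
      (∑ v : Fin n × Fin n × Fin n, if ![v.1, v.2.1, v.2.2] s' = t then off α v else 0) =
        ∑ v : Fin n × Fin n × Fin n, if ![v.1, v.2.1, v.2.2] s' = t then off β v else 0 := by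
    intro s' t
    have key : ∀ α : Fin n × Fin n × Fin n → ℕ,
        (∑ v : Fin n × Fin n × Fin n, if ![v.1, v.2.1, v.2.2] s' = t then α v else 0) =
        (∑ v : Fin n × Fin n × Fin n, if ![v.1, v.2.1, v.2.2] s' = t then off α v else 0) +
        ∑ v : Fin n × Fin n × Fin n, if ![v.1, v.2.1, v.2.2] s' = t then
          (if v.1 = v.2.1 ∧ v.2.1 = v.2.2 then α v else 0) else 0 := by
      intro α
      rw [← Finset.sum_add_distrib]
      refine Finset.sum_congr rfl fun v _ => ?_
      simp only [off]
      split_ifs <;> simp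
    have h := hcol s' t
    rw [key α, key β] at h
    have e : (∑ v : Fin n × Fin n × Fin n, if ![v.1, v.2.1, v.2.2] s' = t then
          (if v.1 = v.2.1 ∧ v.2.1 = v.2.2 then α v else 0) else 0) =
        ∑ v : Fin n × Fin n × Fin n, if ![v.1, v.2.1, v.2.2] s' = t then
          (if v.1 = v.2.1 ∧ v.2.1 = v.2.2 then β v else 0) else 0 := by
      refine Finset.sum_congr rfl fun v _ => ?_
      by_cases h : v.1 = v.2.1 ∧ v.2.1 = v.2.2
      · simp only [if_pos h, hd v h]
      · simp only [if_neg h]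
    rw [e] at h
    exact Nat.add_right_cancel h
  have hp : ∀ (s' : Fin 3) (f : Fin n → ℂ),
      ∏ v : Fin n × Fin n × Fin n, f (![v.1, v.2.1, v.2.2] s') ^ off α v =
      ∏ v : Fin n × Fin n × Fin n, f (![v.1, v.2.1, v.2.2] s') ^ off β v := by
    intro s' f
    rw [aux_fiber (fun v : Fin n × Fin n × Fin n => ![v.1, v.2.1, v.2.2] s') f,
      aux_fiber (fun v : Fin n × Fin n × Fin n => ![v.1, v.2.1, v.2.2] s') f]
    simp only [hoff]
  have hs : ∑ v, off α v = ∑ v, off β v := by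
    rw [aux_sum (fun v : Fin n × Fin n × Fin n => ![v.1, v.2.1, v.2.2] 0),
      aux_sum (fun v : Fin n × Fin n × Fin n => ![v.1, v.2.1, v.2.2] 0) (off β)]
    simp only [hoff]
  have ha : ∏ v, a v.1 ^ off α v = ∏ v, a v.1 ^ off β v := hp 0 a
  have hb : ∏ v, b v.2.1 ^ off α v = ∏ v, b v.2.1 ^ off β v := hp 1 b
  have hc : ∏ v, c v.2.2 ^ off α v = ∏ v, c v.2.2 ^ off β v := hp 2 c
  rw [hsplit α, hsplit β, hs, ha, hb, hc]
  congr 1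
  refine Finset.prod_congr rfl fun v _ => ?_
  by_cases h : v.1 = v.2.1 ∧ v.2.1 = v.2.2
  · simp only [if_pos h, hd v h]
  · simp only [if_neg h]

/-- Common binomial invariants of `QIₙ` and `Mixₙ`.  If the exponent functions `α`, `β`
have, for each position `s' ∈ {1,2,3}` and each value `t`, the same total exponent over the
triples whose `s'`-th index equals `t`, and use each diagonal variable with the same
exponent, then the two monomials agree on every tensor of the mixture model `Mixₙ`
(`P_{ijk} = s aᵢ bⱼ c_k + dᵢ` on the diagonal, `s aᵢ bⱼ c_k` off it) and on every tensor of
the quasi-independence model `QIₙ` (`Q_{ijk} = ζ γᵢ aᵢ bⱼ c_k` on the diagonal,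
`ζ aᵢ bⱼ c_k` off it). -/
theorem QI_Mix_binomial_invariants (n : ℕ) (hn : 1 ≤ n) (s ζ : ℂ)
    (γ a b c d : Fin n → ℂ) (α β : Fin n × Fin n × Fin n → ℕ)
    (hcol : ∀ (s' : Fin 3) (t : Fin n),
      (∑ v : Fin n × Fin n × Fin n, if ![v.1, v.2.1, v.2.2] s' = t then α v else 0) =
        ∑ v : Fin n × Fin n × Fin n, if ![v.1, v.2.1, v.2.2] s' = t then β v else 0)
    (hdiag : ∀ i : Fin n, α (i, i, i) = β (i, i, i)) :
    let P : Fin n × Fin n × Fin n → ℂ := fun v =>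
      if v.1 = v.2.1 ∧ v.2.1 = v.2.2 then s * a v.1 * b v.2.1 * c v.2.2 + d v.1
      else s * a v.1 * b v.2.1 * c v.2.2
    let Q : Fin n × Fin n × Fin n → ℂ := fun v =>
      if v.1 = v.2.1 ∧ v.2.1 = v.2.2 then ζ * γ v.1 * a v.1 * b v.2.1 * c v.2.2
      else ζ * a v.1 * b v.2.1 * c v.2.2
    ((∏ v : Fin n × Fin n × Fin n, P v ^ α v) = ∏ v : Fin n × Fin n × Fin n, P v ^ β v) ∧
      ((∏ v : Fin n × Fin n × Fin n, Q v ^ α v) = ∏ v : Fin n × Fin n × Fin n, Q v ^ β v) := by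
  intro P Q
  exact ⟨aux_main s a b c _ α β hcol hdiag, aux_main ζ a b c _ α β hcol hdiag⟩
end

section
/- Fix n ≥ 1, let α ∈ ℝ and a, b, c ∈ ℝⁿ, and define the n×n×n tensor P by P_{ijk} = α·aᵢbⱼc_k + (1−α)/n if i=j=k and P_{ijk} = α·aᵢbⱼc_k otherwise. Let i, j, k, l, m ∈ {1,…,n} satisfy i ≠ j, k ∉ {i,j}, ¬(k=l=m), ¬(l=m=i) and ¬(l=m=j). Then P_{iii}·P_{klm} − P_{jjj}·P_{klm} + P_{kjj}·P_{jlm} − P_{kii}·P_{ilm} = 0. -/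
/-- An explicit invariant of the model `mixₙ` (case (ii) of the theorem on invariants of
`mixₙ`): for a tensor `P_{ijk} = α aᵢ bⱼ c_k + (1−α)/n` on the diagonal and
`P_{ijk} = α aᵢ bⱼ c_k` off it, and indices `i ≠ j`, `k ∉ {i,j}`, with `¬(k=l=m)`,
`¬(l=m=i)` and `¬(l=m=j)`, one has
`P_{iii}P_{klm} − P_{jjj}P_{klm} + P_{kjj}P_{jlm} − P_{kii}P_{ilm} = 0`. -/
theorem mix_invariant_case_ii (n : ℕ) (hn : 1 ≤ n) (α : ℝ) (a b c : Fin n → ℝ)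
    (i j k l m : Fin n) (hij : i ≠ j) (hki : k ≠ i) (hkj : k ≠ j)
    (hklm : ¬(k = l ∧ l = m)) (hlmi : ¬(l = m ∧ m = i)) (hlmj : ¬(l = m ∧ m = j)) :
    let P : Fin n × Fin n × Fin n → ℝ := fun v =>
      if v.1 = v.2.1 ∧ v.2.1 = v.2.2 then α * a v.1 * b v.2.1 * c v.2.2 + (1 - α) / n
      else α * a v.1 * b v.2.1 * c v.2.2
    P (i, i, i) * P (k, l, m) - P (j, j, j) * P (k, l, m) +
      P (k, j, j) * P (j, l, m) - P (k, i, i) * P (i, l, m) = 0 := by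
  intro P
  have h1 : ¬(i = l ∧ l = m) := fun h => hlmi ⟨h.2, h.2.symm.trans h.1.symm⟩
  have h2 : ¬(j = l ∧ l = m) := fun h => hlmj ⟨h.2, h.2.symm.trans h.1.symm⟩
  have e1 : P (i, i, i) = α * a i * b i * c i + (1 - α) / n := if_pos ⟨rfl, rfl⟩
  have e2 : P (j, j, j) = α * a j * b j * c j + (1 - α) / n := if_pos ⟨rfl, rfl⟩
  have e3 : P (k, l, m) = α * a k * b l * c m := if_neg hklm
  have e4 : P (k, j, j) = α * a k * b j * c j := if_neg fun h => hkj h.1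
  have e5 : P (j, l, m) = α * a j * b l * c m := if_neg h2
  have e6 : P (k, i, i) = α * a k * b i * c i := if_neg fun h => hki h.1
  have e7 : P (i, l, m) = α * a i * b l * c m := if_neg h1
  rw [e1, e2, e3, e4, e5, e6, e7]
  ring
end

section
/- Fix n ≥ 1, let α ∈ ℝ and a, b, c ∈ ℝⁿ, and define the n×n×n tensor P by P_{ijk} = α·aᵢbⱼc_k + (1−α)/n if i=j=k and P_{ijk} = α·aᵢbⱼc_k otherwise. Then for all pairwise distinct i, j, k ∈ {1,…,n}: P_{iii}P_{jjj}² − P_{iii}²P_{jjj} + P_{iii}²P_{kkk} − P_{iii}P_{kkk}² + P_{jjj}P_{kkk}² − P_{jjj}²P_{kkk} + P_{iii}P_{jii}P_{ijj} − P_{jjj}P_{jii}P_{ijj} + P_{kkk}P_{kii}P_{ikk} − P_{iii}P_{kii}P_{ikk} + P_{jjj}P_{kjj}P_{jkk} − P_{kkk}P_{kjj}P_{jkk} = 0. -/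
/-- An explicit invariant of the model `mixₙ` (case (vi) of the theorem on invariants of
`mixₙ`): for a tensor `P_{ijk} = α aᵢ bⱼ c_k + (1−α)/n` on the diagonal and
`P_{ijk} = α aᵢ bⱼ c_k` off it, and pairwise distinct indices `i`, `j`, `k`, the stated
degree-three polynomial identity holds. -/
theorem mix_invariant_case_vi (n : ℕ) (hn : 1 ≤ n) (α : ℝ) (a b c : Fin n → ℝ)
    (i j k : Fin n) (hij : i ≠ j) (hik : i ≠ k) (hjk : j ≠ k) :
    let P : Fin n × Fin n × Fin n → ℝ := fun v =>
      if v.1 = v.2.1 ∧ v.2.1 = v.2.2 then α * a v.1 * b v.2.1 * c v.2.2 + (1 - α) / n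
      else α * a v.1 * b v.2.1 * c v.2.2
    P (i, i, i) * P (j, j, j) ^ 2 - P (i, i, i) ^ 2 * P (j, j, j) +
      P (i, i, i) ^ 2 * P (k, k, k) - P (i, i, i) * P (k, k, k) ^ 2 +
      P (j, j, j) * P (k, k, k) ^ 2 - P (j, j, j) ^ 2 * P (k, k, k) +
      P (i, i, i) * P (j, i, i) * P (i, j, j) - P (j, j, j) * P (j, i, i) * P (i, j, j) +
      P (k, k, k) * P (k, i, i) * P (i, k, k) - P (i, i, i) * P (k, i, i) * P (i, k, k) +
      P (j, j, j) * P (k, j, j) * P (j, k, k) - P (k, k, k) * P (k, j, j) * P (j, k, k) = 0 := by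
  intro P
  simp only [P, and_self, if_true, hij, hik, hjk, hij.symm, hik.symm, hjk.symm, false_and, if_false]
  ring
end

section
/- Fix n ≥ 2 and let P be an n×n×n probability tensor (all entries nonnegative summing to 1) with all entries strictly positive. If P belongs to the model Mixₙ, i.e., there exist α ∈ [0,1] and nonnegative vectors a, b, c, d ∈ ℝⁿ each with coordinate sum 1 such that P_{ijk} = α aᵢbⱼc_k + (1−α)dᵢ when i=j=k and P_{ijk} = α aᵢbⱼc_k otherwise, then P belongs to the model QIₙ, i.e., there exist nonnegative real numbers ζ, γ₁,…,γₙ and nonnegative vectors a', b', c' ∈ ℝⁿ such that P_{ijk} = ζγᵢa'ᵢb'ⱼc'_k when i=j=k and P_{ijk} = ζa'ᵢb'ⱼc'_k otherwise. -/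
/-- In the open simplex (all entries strictly positive), the mixture model `Mixₙ` is
contained in the quasi-independence model `QIₙ`: a strictly positive probability tensor of
the form `P_{ijk} = α aᵢ bⱼ c_k + (1−α) dᵢ` on the diagonal and `P_{ijk} = α aᵢ bⱼ c_k`
off it also admits a representation `P_{ijk} = ζ γᵢ a'ᵢ b'ⱼ c'_k` on the diagonal and
`P_{ijk} = ζ a'ᵢ b'ⱼ c'_k` off it, with nonnegative parameters. -/
theorem Mix_subset_QI_open_simplex (n : ℕ) (hn : 2 ≤ n)
    (P : Fin n × Fin n × Fin n → ℝ)
    (hpos : ∀ v, 0 < P v) (hsum : ∑ v : Fin n × Fin n × Fin n, P v = 1)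
    (hmix : ∃ (α : ℝ) (a b c d : Fin n → ℝ),
      0 ≤ α ∧ α ≤ 1 ∧
      (∀ i, 0 ≤ a i) ∧ (∀ i, 0 ≤ b i) ∧ (∀ i, 0 ≤ c i) ∧ (∀ i, 0 ≤ d i) ∧
      (∑ i, a i) = 1 ∧ (∑ i, b i) = 1 ∧ (∑ i, c i) = 1 ∧ (∑ i, d i) = 1 ∧
      ∀ v : Fin n × Fin n × Fin n,
        P v = if v.1 = v.2.1 ∧ v.2.1 = v.2.2
          then α * a v.1 * b v.2.1 * c v.2.2 + (1 - α) * d v.1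
          else α * a v.1 * b v.2.1 * c v.2.2) :
    ∃ (ζ : ℝ) (γ a' b' c' : Fin n → ℝ),
      0 ≤ ζ ∧ (∀ i, 0 ≤ γ i) ∧ (∀ i, 0 ≤ a' i) ∧ (∀ i, 0 ≤ b' i) ∧ (∀ i, 0 ≤ c' i) ∧
      ∀ v : Fin n × Fin n × Fin n,
        P v = if v.1 = v.2.1 ∧ v.2.1 = v.2.2
          then ζ * γ v.1 * a' v.1 * b' v.2.1 * c' v.2.2
          else ζ * a' v.1 * b' v.2.1 * c' v.2.2 := by
  obtain ⟨α, a, b, c, d, hα, -, ha, hb, hc, -, -, -, -, -, hP⟩ := hmix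
  have key : ∀ i, α * a i * b i * c i ≠ 0 := by
    intro i
    haveI : Nontrivial (Fin n) := Fin.nontrivial_iff_two_le.mpr hn
    obtain ⟨j, hj⟩ := exists_ne i
    have h1 := hpos (i, j, j)
    have h2 := hpos (j, i, j)
    have h3 := hpos (j, j, i)
    rw [hP, if_neg (by rintro ⟨h, -⟩; exact hj h.symm)] at h1
    rw [hP, if_neg (by rintro ⟨h, -⟩; exact hj h)] at h2
    rw [hP, if_neg (by rintro ⟨-, h⟩; exact hj h)] at h3
    have e1 := h1.ne'
    have e2 := h2.ne'
    have e3 := h3.ne'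
    simp only [ne_eq, mul_eq_zero, not_or] at e1 e2 e3 ⊢
    tauto
  refine ⟨α, fun i => P (i, i, i) / (α * a i * b i * c i), a, b, c, hα, ?_, ha, hb, hc, ?_⟩
  · intro i
    exact div_nonneg (hpos _).le
      (mul_nonneg (mul_nonneg (mul_nonneg hα (ha i)) (hb i)) (hc i))
  · rintro ⟨i, j, k⟩
    by_cases h : i = j ∧ j = k
    · obtain ⟨rfl, rfl⟩ := h
      rw [if_pos ⟨rfl, rfl⟩]
      have e := div_mul_cancel₀ (P (i, i, i)) (key i)
      dsimp only
      linear_combination -e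
    · rw [hP, if_neg h, if_neg h]
end

section
/- Fix n ≥ 2 and let d ∈ ℝⁿ have all coordinates strictly positive with Σᵢ dᵢ = 1. Define the diagonal tensor P by P_{iii} = dᵢ and P_{ijk} = 0 whenever i, j, k are not all equal. Then P belongs to the model Mixₙ, but P does not belong to the model QIₙ: there exist no nonnegative real numbers ζ, γ₁,…,γₙ and nonnegative vectors a, b, c ∈ ℝⁿ with P_{ijk} = ζγᵢaᵢbⱼc_k when i=j=k and P_{ijk} = ζaᵢbⱼc_k otherwise. -/
/-- A diagonal probability tensor with strictly positive diagonal `d` belongs to the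
mixture model `Mixₙ` but not to the quasi-independence model `QIₙ`: on the boundary of the
simplex the inclusion `Mixₙ ⊆ QIₙ` fails. -/
theorem diagonal_in_Mix_not_in_QI (n : ℕ) (hn : 2 ≤ n) (d : Fin n → ℝ)
    (hd : ∀ i, 0 < d i) (hdsum : ∑ i, d i = 1) :
    let P : Fin n × Fin n × Fin n → ℝ := fun v =>
      if v.1 = v.2.1 ∧ v.2.1 = v.2.2 then d v.1 else 0
    -- P belongs to Mixₙ
    (∃ (α : ℝ) (a b c d' : Fin n → ℝ),
      0 ≤ α ∧ α ≤ 1 ∧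
      (∀ i, 0 ≤ a i) ∧ (∀ i, 0 ≤ b i) ∧ (∀ i, 0 ≤ c i) ∧ (∀ i, 0 ≤ d' i) ∧
      (∑ i, a i) = 1 ∧ (∑ i, b i) = 1 ∧ (∑ i, c i) = 1 ∧ (∑ i, d' i) = 1 ∧
      ∀ v : Fin n × Fin n × Fin n,
        P v = if v.1 = v.2.1 ∧ v.2.1 = v.2.2
          then α * a v.1 * b v.2.1 * c v.2.2 + (1 - α) * d' v.1
          else α * a v.1 * b v.2.1 * c v.2.2) ∧
    -- P does not belong to QIₙ
    ¬ (∃ (ζ : ℝ) (γ a b c : Fin n → ℝ),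
      0 ≤ ζ ∧ (∀ i, 0 ≤ γ i) ∧ (∀ i, 0 ≤ a i) ∧ (∀ i, 0 ≤ b i) ∧ (∀ i, 0 ≤ c i) ∧
      ∀ v : Fin n × Fin n × Fin n,
        P v = if v.1 = v.2.1 ∧ v.2.1 = v.2.2
          then ζ * γ v.1 * a v.1 * b v.2.1 * c v.2.2
          else ζ * a v.1 * b v.2.1 * c v.2.2) := by
  intro P
  have h0 : ∀ i, 0 ≤ d i := fun i => (hd i).le
  refine ⟨⟨0, d, d, d, d, le_refl _, zero_le_one, h0, h0, h0, h0, hdsum, hdsum, hdsum, hdsum,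
    fun v => ?_⟩, ?_⟩
  · simp [P]
  · rintro ⟨ζ, γ, a, b, c, -, -, -, -, -, h⟩
    let x : Fin n := ⟨0, by omega⟩
    let y : Fin n := ⟨1, by omega⟩
    have hxy : x ≠ y := by simp [x, y]
    have h1 := h (x, x, x)
    have h2 := h (y, y, y)
    have h3 := h (x, x, y)
    simp only [P, and_self, if_true] at h1 h2
    simp only [P, hxy, and_false, if_false] at h3
    have p1 := (hd x).ne'
    have p2 := (hd y).ne'
    rw [h1] at p1
    rw [h2] at p2
    simp only [ne_eq, mul_eq_zero, not_or] at p1 p2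
    have h4 := h3.symm
    simp only [mul_eq_zero] at h4
    tauto
end

section
/- Fix n ≥ 2. (a) If P is an n×n×n probability tensor with P₁₁₁ = 0 and P_{ijk} > 0 for every triple (i,j,k) ≠ (1,1,1), then P does not belong to the model Mixₙ: there exist no α ∈ [0,1] and nonnegative vectors a, b, c, d ∈ ℝⁿ each summing to 1 with P_{ijk} = α aᵢbⱼc_k + (1−α)dᵢ when i=j=k and P_{ijk} = α aᵢbⱼc_k otherwise. (b) There exists such a tensor P belonging to the model QIₙ, obtained by taking γ₁ = 0 and all other parameters strictly positive in the QIₙ parametrization. -/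
/-- On the boundary of the simplex the inclusion `QIₙ ⊆ Mixₙ` fails.
(a) A probability tensor with `P₁₁₁ = 0` and all other entries strictly positive does not
belong to the mixture model `Mixₙ`.
(b) There exists such a tensor belonging to `QIₙ`, obtained by taking `γ₁ = 0` and all
other parameters strictly positive. -/
theorem QI_not_subset_Mix_boundary (n : ℕ) (hn : 2 ≤ n) :
    let v0 : Fin n × Fin n × Fin n := (⟨0, by omega⟩, ⟨0, by omega⟩, ⟨0, by omega⟩)
    -- (a)
    ((∀ P : Fin n × Fin n × Fin n → ℝ,
      (∀ v, 0 ≤ P v) → (∑ v : Fin n × Fin n × Fin n, P v) = 1 →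
      P v0 = 0 → (∀ v, v ≠ v0 → 0 < P v) →
      ¬ (∃ (α : ℝ) (a b c d : Fin n → ℝ),
        0 ≤ α ∧ α ≤ 1 ∧
        (∀ i, 0 ≤ a i) ∧ (∀ i, 0 ≤ b i) ∧ (∀ i, 0 ≤ c i) ∧ (∀ i, 0 ≤ d i) ∧
        (∑ i, a i) = 1 ∧ (∑ i, b i) = 1 ∧ (∑ i, c i) = 1 ∧ (∑ i, d i) = 1 ∧
        ∀ v : Fin n × Fin n × Fin n,
          P v = if v.1 = v.2.1 ∧ v.2.1 = v.2.2
            then α * a v.1 * b v.2.1 * c v.2.2 + (1 - α) * d v.1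
            else α * a v.1 * b v.2.1 * c v.2.2)) ∧
    -- (b)
    (∃ P : Fin n × Fin n × Fin n → ℝ,
      (∀ v, 0 ≤ P v) ∧ (∑ v : Fin n × Fin n × Fin n, P v) = 1 ∧
      P v0 = 0 ∧ (∀ v, v ≠ v0 → 0 < P v) ∧
      ∃ (ζ : ℝ) (γ a b c : Fin n → ℝ),
        0 < ζ ∧ γ v0.1 = 0 ∧ (∀ i, i ≠ v0.1 → 0 < γ i) ∧
        (∀ i, 0 < a i) ∧ (∀ i, 0 < b i) ∧ (∀ i, 0 < c i) ∧
        ∀ v : Fin n × Fin n × Fin n,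
          P v = if v.1 = v.2.1 ∧ v.2.1 = v.2.2
            then ζ * γ v.1 * a v.1 * b v.2.1 * c v.2.2
            else ζ * a v.1 * b v.2.1 * c v.2.2)) := by
  intro v0
  have hne : (⟨1, by omega⟩ : Fin n) ≠ ⟨0, by omega⟩ := by simp [Fin.ext_iff]
  have hne' : (⟨0, by omega⟩ : Fin n) ≠ ⟨1, by omega⟩ := by simp [Fin.ext_iff]
  refine ⟨?_, ?_⟩
  · rintro P - - h0 hpos ⟨α, a, b, c, d, hα, hα1, ha, hb, hc, hd, -, -, -, -, hP⟩
    have h1 := hpos (⟨0, by omega⟩, ⟨0, by omega⟩, ⟨1, by omega⟩) (by simp [v0])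
    have h2 := hpos (⟨0, by omega⟩, ⟨1, by omega⟩, ⟨0, by omega⟩) (by simp [v0])
    rw [hP, if_neg (by simp)] at h1
    rw [hP, if_neg (by simp)] at h2
    rw [hP, if_pos (by simp [v0])] at h0
    simp only [v0] at h0 h1 h2
    have e1 : 0 < α * a ⟨0, by omega⟩ * b ⟨0, by omega⟩ := pos_of_mul_pos_left h1 (hc _)
    have e2 : 0 < c ⟨0, by omega⟩ :=
      pos_of_mul_pos_right h2 (mul_nonneg (mul_nonneg hα (ha _)) (hb _))
    have e3 := mul_pos e1 e2
    have e4 := mul_nonneg (sub_nonneg.2 hα1) (hd ⟨0, by omega⟩)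
    linarith
  · let Q : Fin n × Fin n × Fin n → ℝ := fun v => if v = v0 then 0 else 1
    have hQ : ∀ v, 0 ≤ Q v := fun v => by simp only [Q]; split_ifs <;> norm_num
    have hQ1 : ∀ v, v ≠ v0 → Q v = 1 := fun v hv => by simp [Q, hv]
    have hS : 0 < ∑ v, Q v := by
      refine Finset.sum_pos' (fun v _ => hQ v)
        ⟨(⟨0, by omega⟩, ⟨0, by omega⟩, ⟨1, by omega⟩), Finset.mem_univ _, ?_⟩
      rw [hQ1 _ (by simp [v0])]; norm_num
    refine ⟨fun v => (∑ v, Q v)⁻¹ * Q v, fun v => mul_nonneg (inv_nonneg.2 hS.le) (hQ v), ?_,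
      by simp [Q], fun v hv => ?_, (∑ v, Q v)⁻¹, fun i => if i = v0.1 then 0 else 1,
      fun _ => 1, fun _ => 1, fun _ => 1, inv_pos.2 hS, by simp, fun i hi => by simp [hi],
      by simp, by simp, by simp, ?_⟩
    · rw [← Finset.mul_sum, inv_mul_cancel₀ hS.ne']
    · simp only [hQ1 v hv, mul_one]; exact inv_pos.2 hS
    · rintro ⟨i, j, k⟩
      simp only [mul_one]
      generalize (∑ v, Q v)⁻¹ = t
      simp only [Q, v0, Prod.mk.injEq]
      split_ifs <;> grind
end

section
/- Fix n ≥ 2 and strictly positive real numbers γ₁₂, γ₁₃, γ₂₃. Set T = γ₁₂γ₁₃γ₂₃ + (n−1)(γ₁₂+γ₁₃+γ₂₃) + (n−1)(n−2), define w_{ijk} = γ₁₂^{δ(i=j)}·γ₁₃^{δ(i=k)}·γ₂₃^{δ(j=k)} for 1 ≤ i,j,k ≤ n, and let P_{ijk} = w_{ijk} / Σ_{i',j',k'} w_{i'j'k'} (this is the tensor of the model p-qIₙ with uniform marginals a = b = c = (1/n,…,1/n)). Let 𝑃̃_{ij} = Σ_k P_{ijk} be the (1,2)-marginal table and let κ₁₂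 = (Σᵢ 𝑃̃_{ii} − Σᵢ (Σⱼ 𝑃̃_{ij})(Σⱼ 𝑃̃_{ji})) / (1 − Σᵢ (Σⱼ 𝑃̃_{ij})(Σⱼ 𝑃̃_{ji})) be the Cohen's κ of this marginal. Then κ₁₂ = (γ₁₂γ₁₃γ₂₃ + (n−1)γ₁₂ − γ₁₃ − γ₂₃ − n + 2) / T. -/
theorem pq_ksum (n : ℕ) (a b c : ℝ) (i j : Fin n) :
    ∑ k : Fin n, (if i = j then a else 1) * (if i = k then b else 1) * (if j = k then c else 1)
      = ((n : ℝ) + (b - 1) + (c - 1)) +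
        (if i = j then a * (n + (b - 1) + (c - 1) + (b - 1) * (c - 1)) -
          (n + (b - 1) + (c - 1)) else 0) := by
  have h : ∀ k : Fin n,
      (if i = j then a else 1) * (if i = k then b else 1) * (if j = k then c else 1)
      = (if i = j then a else 1) * (1 + (if i = k then b - 1 else 0) + (if j = k then c - 1 else 0)
        + (if i = k then (if i = j then (b - 1) * (c - 1) else 0) else 0)) := by
    intro k
    by_cases h1 : i = j
    · subst h1
      by_cases h2 : i = k
      · simp only [h2, if_true]; ring
      · simp [h2]
    · by_cases h2 : i = k
      · subst h2
        have h3 : ¬ j = i := fun h => h1 h.symm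
        simp [h1, h3]
      · simp [h1, h2]; split_ifs <;> ring
  rw [Finset.sum_congr rfl (fun k _ => h k), ← Finset.mul_sum]
  simp only [Finset.sum_add_distrib, Finset.sum_ite_eq, Finset.mem_univ, if_true,
    Finset.sum_const, Finset.card_univ, Fintype.card_fin, nsmul_eq_mul, mul_one]
  split_ifs <;> ring

/-- Cohen's `κ₁₂` for the model `p-qIₙ` with equal uniform marginals
`a = b = c = (1/n, …, 1/n)`: the tensor is proportional to
`w_{ijk} = γ₁₂^{δ(i=j)} γ₁₃^{δ(i=k)} γ₂₃^{δ(j=k)}`, and its pairwise Cohen's kappa for the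
first two raters equals
`(γ₁₂γ₁₃γ₂₃ + (n−1)γ₁₂ − γ₁₃ − γ₂₃ − n + 2) / T`, with
`T = γ₁₂γ₁₃γ₂₃ + (n−1)(γ₁₂+γ₁₃+γ₂₃) + (n−1)(n−2)`. -/
theorem pqI_kappa12 (n : ℕ) (hn : 2 ≤ n) (g12 g13 g23 : ℝ)
    (h12 : 0 < g12) (h13 : 0 < g13) (h23 : 0 < g23) :
    let T : ℝ := g12 * g13 * g23 + ((n : ℝ) - 1) * (g12 + g13 + g23) +
      ((n : ℝ) - 1) * ((n : ℝ) - 2)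
    let w : Fin n × Fin n × Fin n → ℝ := fun v =>
      (if v.1 = v.2.1 then g12 else 1) * (if v.1 = v.2.2 then g13 else 1) *
        (if v.2.1 = v.2.2 then g23 else 1)
    let P : Fin n × Fin n × Fin n → ℝ := fun v => w v / ∑ v' : Fin n × Fin n × Fin n, w v'
    let Pt : Fin n → Fin n → ℝ := fun i j => ∑ k, P (i, j, k)
    let kappa12 : ℝ :=
      ((∑ i, Pt i i) - ∑ i, (∑ j, Pt i j) * (∑ j, Pt j i)) /
        (1 - ∑ i, (∑ j, Pt i j) * (∑ j, Pt j i))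
    kappa12 = (g12 * g13 * g23 + ((n : ℝ) - 1) * g12 - g13 - g23 - (n : ℝ) + 2) / T := by
  intro T w P Pt kappa12
  have hn' : (2 : ℝ) ≤ n := by exact_mod_cast hn
  have hT : 0 < T := by
    have e1 : 0 < g12 * g13 * g23 := by positivity
    have e2 : 0 ≤ ((n : ℝ) - 1) * (g12 + g13 + g23) :=
      mul_nonneg (by linarith) (by linarith)
    have e3 : 0 ≤ ((n : ℝ) - 1) * ((n : ℝ) - 2) := mul_nonneg (by linarith) (by linarith)
    show 0 < _ + _ + _
    linarith
  have hk : ∀ i j, ∑ k, w (i, j, k) = _ := fun i j => pq_ksum n g12 g13 g23 i j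
  have hrow : ∀ i, ∑ j, ∑ k, w (i, j, k) = T := by
    intro i
    simp only [hk, Finset.sum_add_distrib, Finset.sum_ite_eq, Finset.mem_univ, if_true,
      Finset.sum_const, Finset.card_univ, Fintype.card_fin, nsmul_eq_mul, T]
    ring
  have hcol : ∀ i, ∑ j, ∑ k, w (j, i, k) = T := by
    intro i
    simp only [hk, Finset.sum_add_distrib, Finset.sum_ite_eq', Finset.mem_univ, if_true,
      Finset.sum_const, Finset.card_univ, Fintype.card_fin, nsmul_eq_mul, T]
    ring
  have htot : ∑ v, w v = n * T := by
    simp only [Fintype.sum_prod_type, hrow, Finset.sum_const, Finset.card_univ,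
      Fintype.card_fin, nsmul_eq_mul]
  have hPt : ∀ i j, Pt i j = (∑ k, w (i, j, k)) / (n * T) := by
    intro i j
    simp only [Pt, P, htot, Finset.sum_div]
  have hr : ∀ i, ∑ j, Pt i j = T / (n * T) := by
    intro i
    simp only [hPt, ← Finset.sum_div, hrow]
  have hc : ∀ i, ∑ j, Pt j i = T / (n * T) := by
    intro i
    simp only [hPt, ← Finset.sum_div, hcol]
  have hd : ∑ i, Pt i i = (g12 * g13 * g23 + ((n : ℝ) - 1) * g12) / T := by
    simp only [hPt, hk, if_true, Finset.sum_const, Finset.card_univ, Fintype.card_fin,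
      nsmul_eq_mul]
    field_simp
    ring
  have hN : (n : ℝ) - 1 ≠ 0 := by linarith
  have hn0 : (n : ℝ) ≠ 0 := by linarith
  have he : ∑ i, (∑ j, Pt i j) * (∑ j, Pt j i) = 1 / n := by
    simp only [hr, hc, Finset.sum_const, Finset.card_univ, Fintype.card_fin, nsmul_eq_mul]
    field_simp
  have hden : (1 : ℝ) - 1 / n = (n - 1) / n := by field_simp
  show ((∑ i, Pt i i) - ∑ i, (∑ j, Pt i j) * (∑ j, Pt j i)) /
        (1 - ∑ i, (∑ j, Pt i j) * (∑ j, Pt j i)) = _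
  rw [he, hd, hden]
  have hT0 : T ≠ 0 := hT.ne'
  have hTd : T = g12 * g13 * g23 + ((n : ℝ) - 1) * (g12 + g13 + g23) +
      ((n : ℝ) - 1) * ((n : ℝ) - 2) := rfl
  clear_value T
  field_simp
  rw [hTd]
  ring
end

section
/- Fix n ≥ 2 and nonnegative real numbers α₀, α₁₂, α₁₃, α₂₃, α₁₂₃ with α₀ + α₁₂ + α₁₃ + α₂₃ + α₁₂₃ = 1. Define the tensor P by P_{ijk} = α₀/n³ + α₁₂·δ(i=j)/n² + α₁₃·δ(i=k)/n² + α₂₃·δ(j=k)/n² + α₁₂₃·δ(i=j=k)/n (this is the tensor of the model p-mixₙ with uniform marginals a = b = c = (1/n,…,1/n)). Let 𝑃̃_{ij} = Σ_k P_{ijk} and let κ₁₂ = (Σᵢ 𝑃̃_{ii} − Σᵢ (Σⱼ 𝑃̃_{ij})(Σⱼ 𝑃̃_{ji})) / (1 − Σᵢ (Σⱼ 𝑃̃_{ij})(Σⱼ 𝑃̃_{ji})). Then κ₁₂ = α₁₂ + α₁₂₃. -/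
/-- Cohen's `κ₁₂` for the model `p-mixₙ` with equal uniform marginals
`a = b = c = (1/n, …, 1/n)`: the tensor is
`P_{ijk} = α₀/n³ + α₁₂ δ(i=j)/n² + α₁₃ δ(i=k)/n² + α₂₃ δ(j=k)/n² + α₁₂₃ δ(i=j=k)/n`,
and its pairwise Cohen's kappa for the first two raters equals `α₁₂ + α₁₂₃`. -/
theorem pmix_kappa12 (n : ℕ) (hn : 2 ≤ n) (a0 a12 a13 a23 a123 : ℝ)
    (h0 : 0 ≤ a0) (h12 : 0 ≤ a12) (h13 : 0 ≤ a13) (h23 : 0 ≤ a23) (h123 : 0 ≤ a123)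
    (hsum : a0 + a12 + a13 + a23 + a123 = 1) :
    let P : Fin n × Fin n × Fin n → ℝ := fun v =>
      a0 / (n : ℝ) ^ 3 + (if v.1 = v.2.1 then a12 / (n : ℝ) ^ 2 else 0) +
        (if v.1 = v.2.2 then a13 / (n : ℝ) ^ 2 else 0) +
        (if v.2.1 = v.2.2 then a23 / (n : ℝ) ^ 2 else 0) +
        (if v.1 = v.2.1 ∧ v.2.1 = v.2.2 then a123 / (n : ℝ) else 0)
    let Pt : Fin n → Fin n → ℝ := fun i j => ∑ k, P (i, j, k)
    let kappa12 : ℝ :=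
      ((∑ i, Pt i i) - ∑ i, (∑ j, Pt i j) * (∑ j, Pt j i)) /
        (1 - ∑ i, (∑ j, Pt i j) * (∑ j, Pt j i))
    kappa12 = a12 + a123 := by
  intro P Pt kappa12
  have hn2 : (2 : ℝ) ≤ n := by exact_mod_cast hn
  have hn0 : (n : ℝ) ≠ 0 := by linarith
  have hn1 : (n : ℝ) - 1 ≠ 0 := by linarith
  have hPt : ∀ i j, Pt i j = (a0 + a13 + a23) / (n : ℝ) ^ 2
      + if i = j then (a12 + a123) / (n : ℝ) else 0 := by
    intro i j
    by_cases hij : i = j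
    · simp [Pt, P, hij, Finset.sum_add_distrib]
      field_simp
      ring
    · simp [Pt, P, hij, Finset.sum_add_distrib]
      field_simp
  have ha0 : a0 = 1 - a12 - a13 - a23 - a123 := by linarith
  have hr : ∀ i, ∑ j, Pt i j = 1 / (n : ℝ) := by
    intro i
    simp only [hPt, Finset.sum_add_distrib]
    simp
    field_simp
    linarith
  have hc : ∀ i, ∑ j, Pt j i = 1 / (n : ℝ) := by
    intro i
    simp only [hPt, Finset.sum_add_distrib]
    simp
    field_simp
    linarith
  have hd : ∑ i, Pt i i = (1 - (a12 + a123)) / (n : ℝ) + (a12 + a123) := by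
    simp [hPt]
    field_simp
    rw [ha0]
    ring
  have hs : ∑ i, (∑ j, Pt i j) * (∑ j, Pt j i) = 1 / (n : ℝ) := by
    simp only [hr, hc]
    simp
    field_simp
  have hden : 1 - 1 / (n : ℝ) ≠ 0 := by
    intro h
    apply hn1
    field_simp at h
    linarith
  show ((∑ i, Pt i i) - ∑ i, (∑ j, Pt i j) * (∑ j, Pt j i)) /
        (1 - ∑ i, (∑ j, Pt i j) * (∑ j, Pt j i)) = a12 + a123
  rw [hs, hd, div_eq_iff hden]
  ring
end
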